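/- For every space curve γ of length less than 10 joining A and D, contained in the truncated cone K_{4ΔAOD} ∖ {O}, and disjoint from every strip S_j^k, there exists a plane curve γ̃ contained in 4·Δ(AOD) ∖ {O} joining A and D, disjoint from all segments I_j^k, with l(γ̃) ≤ (5/2)·l(Proj γ). -/

import Mathlib

open Set Real

/-- A point of the rotated Archimedean spiral around the axis `OA` (the first coordinate
axis): it lies in the plane `{x : x₀ = c}`, at distance `ρ₀ - ε·ψ` from the axis, at
angle `ψ` around it. -/
noncomputable def spPt (c ρ₀ ε ψ : ℝ) : EuclideanSpace ℝ (Fin 3) :=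
  (WithLp.equiv 2 (Fin 3 → ℝ)).symm
    ![c, (ρ₀ - ε * ψ) * Real.cos ψ, (ρ₀ - ε * ψ) * Real.sin ψ]

/-- The spiral strip `S = ⋃_{ψ ∈ [0,2πM]} I(ψ)`, where `I(ψ) = {λ·x(ψ) : λ ∈ [1,11]}`. -/
def spiralStrip (c ρ₀ ε : ℝ) (M : ℕ) : Set (EuclideanSpace ℝ (Fin 3)) :=
  {y | ∃ ψ ∈ Icc (0:ℝ) (2 * π * M), ∃ l ∈ Icc (1:ℝ) 11, y = l • spPt c ρ₀ ε ψ}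

/-- Rotation of a point around the first coordinate axis into the half-plane
`{x : x₁ ≥ 0, x₂ = 0}` (the plane of the angle `AOD`). -/
noncomputable def Proj3 (x : EuclideanSpace ℝ (Fin 3)) : EuclideanSpace ℝ (Fin 3) :=
  (WithLp.equiv 2 (Fin 3 → ℝ)).symm ![x 0, Real.sqrt ((x 1) ^ 2 + (x 2) ^ 2), 0]

/-- The labyrinth property (∗₁) for the spiral in the plane `{x : x₀ = c}`. -/
def LabyrinthProp (c ρ₀ ε : ℝ) (M : ℕ) : Prop :=
  ∀ δ : ℝ → EuclideanSpace ℝ (Fin 3), ContinuousOn δ (Icc 0 1) →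
    (∀ t ∈ Icc (0:ℝ) 1, (δ t) 0 = c) →
    δ 0 ∈ segment ℝ (spPt c ρ₀ ε 0) (spPt c ρ₀ ε (2 * π)) →
    δ 1 ∈ segment ℝ (spPt c ρ₀ ε (2 * π * ((M : ℝ) - 1))) (spPt c ρ₀ ε (2 * π * M)) →
    (∀ t ∈ Icc (0:ℝ) 1, ∀ ψ ∈ Icc (0:ℝ) (2 * π * M), δ t ≠ spPt c ρ₀ ε ψ) →
    ENNReal.ofReal 10 ≤ eVariationOn δ (Icc (0:ℝ) 1)

/-- The unit vector in the plane `x₂ = 0` at angle `θ` from the first coordinate axis. -/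
noncomputable def dirPt (θ : ℝ) : EuclideanSpace ℝ (Fin 3) :=
  (WithLp.equiv 2 (Fin 3 → ℝ)).symm ![Real.cos θ, Real.sin θ, 0]

/-- The angular coordinate `θ_j^k = k·(2π)^{-j}·(π/6)` of the segment `I_j^k`. -/
noncomputable def angJK (j k : ℕ) : ℝ := k * (2 * π) ^ (-(j : ℤ)) * (π / 6)

/-- The plane segment `I_j^k = {x : φ_x = θ_j^k, |x| ∈ [2^{-j}, 11·2^{-j}]}` lying in the
plane of the triangle `AOD` (the plane `x₂ = 0`). -/
noncomputable def segJK (j k : ℕ) : Set (EuclideanSpace ℝ (Fin 3)) :=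
  {y | ∃ l ∈ Icc (1:ℝ) 11, y = (l * (2:ℝ) ^ (-(j:ℤ))) • dirPt (angJK j k)}

/-- The axial coordinate of the starting point `x_j^k = 2^{-j}·dirPt θ_j^k`. -/
noncomputable def cJK (j k : ℕ) : ℝ := (2:ℝ) ^ (-(j:ℤ)) * Real.cos (angJK j k)

/-- The radial coordinate (distance to the axis `OA`) of `x_j^k`. -/
noncomputable def rJK (j k : ℕ) : ℝ := (2:ℝ) ^ (-(j:ℤ)) * Real.sin (angJK j k)

/-- `(j,k)` is an admissible index: `j ≥ 1` and `1 ≤ k ≤ k_j = ⌊(2π)^j⌋`. -/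
def validJK (j k : ℕ) : Prop := 1 ≤ j ∧ 1 ≤ k ∧ k ≤ ⌊(2 * π) ^ j⌋₊

section Variation

variable {E : Type*} [PseudoMetricSpace E]

lemma ofReal_add_le_eVariationOn (f : ℝ → E) {a b c x y : ℝ} (hab : a ≤ b) (hbc : b ≤ c)
    (hx0 : 0 ≤ x) (hy0 : 0 ≤ y)
    (hx : ENNReal.ofReal x ≤ eVariationOn f (Icc a b))
    (hy : ENNReal.ofReal y ≤ eVariationOn f (Icc b c)) :
    ENNReal.ofReal (x + y) ≤ eVariationOn f (Icc a c) := by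
  have h := eVariationOn.Icc_add_Icc f (s := univ) hab hbc (mem_univ b)
  simp only [univ_inter] at h
  rw [← h, ENNReal.ofReal_add hx0 hy0]
  exact add_le_add hx hy

lemma ofReal_le_eVariationOn_of_subset (f : ℝ → E) {a b c d x y : ℝ} (hca : c ≤ a) (hbd : b ≤ d)
    (hxy : x ≤ y) (hy : ENNReal.ofReal y ≤ eVariationOn f (Icc a b)) :
    ENNReal.ofReal x ≤ eVariationOn f (Icc c d) :=
  (ENNReal.ofReal_le_ofReal hxy).trans (hy.trans (eVariationOn.mono f (Icc_subset_Icc hca hbd)))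

lemma ofReal_le_eVariationOn_of_le_dist (f : ℝ → E) {a b x : ℝ} (hab : a ≤ b)
    (h : x ≤ dist (f a) (f b)) : ENNReal.ofReal x ≤ eVariationOn f (Icc a b) := by
  refine le_trans ?_ (eVariationOn.edist_le f (left_mem_Icc.2 hab) (right_mem_Icc.2 hab))
  rw [edist_dist]
  exact ENNReal.ofReal_le_ofReal h

/-- If every decrease of `g` by `δ` costs the curve `f` a displacement of at least `r`, then a
decrease of `g` by `n * δ` costs a length of at least `n * r`. -/
lemma ofReal_mul_le_eVariationOn_of_decrease (f : ℝ → E) (g : ℝ → ℝ) {δ r : ℝ} (hδ : 0 ≤ δ)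
    (hr : 0 ≤ r) (n : ℕ) {p q : ℝ} (hpq : p ≤ q) (hg : ContinuousOn g (Icc p q))
    (hdist : ∀ u ∈ Icc p q, ∀ v ∈ Icc p q, g u - g v = δ → r ≤ dist (f u) (f v))
    (hdec : n * δ ≤ g p - g q) :
    ENNReal.ofReal (n * r) ≤ eVariationOn f (Icc p q) := by
  induction n generalizing p with
  | zero => simp
  | succ n ih =>
    push_cast at hdec ⊢
    have hnδ : 0 ≤ n * δ := by positivity
    obtain ⟨v, hv, hgv⟩ := intermediate_value_Icc' hpq hg
      (show g p - δ ∈ Icc (g q) (g p) from ⟨by linarith, by linarith⟩)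
    have h1 := ofReal_le_eVariationOn_of_le_dist f hv.1
      (hdist p (left_mem_Icc.2 hpq) v hv (by linarith))
    have hsub : Icc v q ⊆ Icc p q := Icc_subset_Icc_left hv.1
    have h2 := ih hv.2 (hg.mono hsub) (fun u hu w hw => hdist u (hsub hu) w (hsub hw))
      (by linarith)
    have := ofReal_add_le_eVariationOn f hv.1 hv.2 hr (by positivity) h1 h2
    convert this using 2
    ring

end Variation

/-- A continuous function passing from below `l` to above `u` has a crossing of `[l, u]`. -/
lemma exists_crossing {f : ℝ → ℝ} {a b l u : ℝ} (hab : a ≤ b) (hf : ContinuousOn f (Icc a b))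
    (ha : f a ≤ l) (hlu : l ≤ u) (hb : u ≤ f b) :
    ∃ p q, a ≤ p ∧ p ≤ q ∧ q ≤ b ∧ f p = l ∧ f q = u ∧ ∀ t ∈ Icc p q, f t ∈ Icc l u := by
  obtain ⟨q₀, hq₀, hfq₀⟩ := intermediate_value_Icc hab hf (show u ∈ _ from ⟨ha.trans hlu, hb⟩)
  have hcl : ∀ {c d y : ℝ}, Icc c d ⊆ Icc a b → IsCompact (Icc c d ∩ f ⁻¹' {y}) := by
    intro c d y hsub
    exact isCompact_Icc.of_isClosed_subset
      ((hf.mono hsub).preimage_isClosed_of_isClosed isClosed_Icc isClosed_singleton)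
      inter_subset_left
  have hne : (Icc a q₀ ∩ f ⁻¹' {l}).Nonempty := by
    obtain ⟨p, hp, hfp⟩ := intermediate_value_Icc hq₀.1 (hf.mono (Icc_subset_Icc_right hq₀.2))
      (show l ∈ _ from ⟨ha, hlu.trans hfq₀.ge⟩)
    exact ⟨p, hp, hfp⟩
  obtain ⟨p, hpm, hpmax⟩ := (hcl (Icc_subset_Icc_right hq₀.2)).exists_isGreatest hne
  have hpq₀ := hpm.1.2
  have hap := hpm.1.1
  have hfp : f p = l := hpm.2
  have hsub : Icc p q₀ ⊆ Icc a b := Icc_subset_Icc hap hq₀.2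
  obtain ⟨q, hqm, hqmin⟩ := (hcl hsub).exists_isLeast ⟨q₀, ⟨hpq₀, le_rfl⟩, hfq₀⟩
  have hpq := hqm.1.1
  have hfq : f q = u := hqm.2
  refine ⟨p, q, hap, hpq, hqm.1.2.trans hq₀.2, hfp, hfq, fun t ht => ⟨?_, ?_⟩⟩
  · by_contra! hlt
    obtain ⟨t', ht', hft'⟩ := intermediate_value_Icc ht.2
      (hf.mono (Icc_subset_Icc (hap.trans ht.1) (hqm.1.2.trans hq₀.2)))
      (show l ∈ _ from ⟨hlt.le, hlu.trans hfq.ge⟩)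
    have : t' ≤ p := hpmax ⟨⟨hap.trans (ht.1.trans ht'.1), ht'.2.trans hqm.1.2⟩, hft'⟩
    have : t = p := le_antisymm (ht'.1.trans this) ht.1
    rw [this, hfp] at hlt
    exact lt_irrefl _ hlt
  · by_contra! hlt
    obtain ⟨t', ht', hft'⟩ := intermediate_value_Icc ht.1
      (hf.mono (Icc_subset_Icc hap (ht.2.trans (hqm.1.2.trans hq₀.2))))
      (show u ∈ _ from ⟨hfp.trans_le hlu, hlt.le⟩)
    have : q ≤ t' := hqmin ⟨⟨ht'.1, ht'.2.trans (ht.2.trans hqm.1.2)⟩, hft'⟩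
    have : t = q := le_antisymm ht.2 (this.trans ht'.2)
    rw [this, hfq] at hlt
    exact lt_irrefl _ hlt

lemma sub_le_tan_sub_tan {x y : ℝ} (hx : 0 ≤ x) (hxy : x ≤ y) (hy : y ≤ π / 6) :
    y - x ≤ tan y - tan x := by
  have hcos : ∀ z ∈ Icc (0:ℝ) (π / 6), cos z ≠ 0 := fun z hz =>
    (cos_pos_of_mem_Ioo ⟨by linarith [hz.1, pi_pos], by linarith [hz.2, pi_pos]⟩).ne'
  have := (convex_Icc (0:ℝ) (π / 6)).mul_sub_le_image_sub_of_le_deriv (f := tan) (C := 1)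
    (continuousOn_tan.mono hcos)
    (fun z hz => (differentiableAt_tan.2 (hcos z (interior_subset hz))).differentiableWithinAt)
    (fun z hz => by
      have h := hcos z (interior_subset hz)
      rw [deriv_tan, le_div_iff₀ (by positivity)]
      nlinarith [sin_sq_add_cos_sq z, sq_nonneg (sin z)])
    x ⟨hx, hxy.trans hy⟩ y ⟨hx.trans hxy, hy⟩ hxy
  linarith

lemma cos_sq_ge_of_le {z : ℝ} (h0 : 0 ≤ z) (h : z ≤ π / 6) : 3 / 4 ≤ cos z ^ 2 := by
  have h1 : cos (π / 6) ≤ cos z := cos_le_cos_of_nonneg_of_le_pi h0 (by linarith [pi_pos]) h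
  rw [cos_pi_div_six] at h1
  have h3 : (√3) ^ 2 = (3:ℝ) := Real.sq_sqrt (by norm_num)
  have h4 : 0 ≤ √(3:ℝ) := Real.sqrt_nonneg _
  nlinarith

lemma tan_sub_tan_le {x y : ℝ} (hx : 0 ≤ x) (hxy : x ≤ y) (hy : y ≤ π / 6) :
    tan y - tan x ≤ 4 / 3 * (y - x) := by
  have hcos : ∀ z ∈ Icc (0:ℝ) (π / 6), cos z ≠ 0 := fun z hz =>
    (cos_pos_of_mem_Ioo ⟨by linarith [hz.1, pi_pos], by linarith [hz.2, pi_pos]⟩).ne'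
  exact (convex_Icc (0:ℝ) (π / 6)).image_sub_le_mul_sub_of_deriv_le (f := tan) (C := 4 / 3)
    (continuousOn_tan.mono hcos)
    (fun z hz => (differentiableAt_tan.2 (hcos z (interior_subset hz))).differentiableWithinAt)
    (fun z hz => by
      have h := hcos z (interior_subset hz)
      have h2 := cos_sq_ge_of_le (interior_subset hz).1 (interior_subset hz).2
      rw [deriv_tan, div_le_iff₀ (by positivity)]
      linarith)
    x ⟨hx, hxy.trans hy⟩ y ⟨hx.trans hxy, hy⟩ hxy

@[simp] lemma spPt_apply_zero (c ρ ε ψ : ℝ) : spPt c ρ ε ψ 0 = c := rfl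
@[simp] lemma spPt_apply_one (c ρ ε ψ : ℝ) : spPt c ρ ε ψ 1 = (ρ - ε * ψ) * cos ψ := rfl
@[simp] lemma spPt_apply_two (c ρ ε ψ : ℝ) : spPt c ρ ε ψ 2 = (ρ - ε * ψ) * sin ψ := rfl
@[simp] lemma dirPt_apply_zero (θ : ℝ) : dirPt θ 0 = cos θ := rfl
@[simp] lemma dirPt_apply_one (θ : ℝ) : dirPt θ 1 = sin θ := rfl
@[simp] lemma dirPt_apply_two (θ : ℝ) : dirPt θ 2 = 0 := rfl
@[simp] lemma Proj3_apply_zero (x : EuclideanSpace ℝ (Fin 3)) : Proj3 x 0 = x 0 := rfl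
@[simp] lemma Proj3_apply_one (x : EuclideanSpace ℝ (Fin 3)) :
    Proj3 x 1 = √(x 1 ^ 2 + x 2 ^ 2) := rfl

lemma dist_sq_fin_three (x y : EuclideanSpace ℝ (Fin 3)) :
    dist x y ^ 2 = (x 0 - y 0) ^ 2 + (x 1 - y 1) ^ 2 + (x 2 - y 2) ^ 2 := by
  rw [EuclideanSpace.dist_eq, Real.sq_sqrt (by positivity), Fin.sum_univ_three]
  simp [Real.dist_eq, sq_abs]

lemma abs_apply_zero_sub_le_dist (x y : EuclideanSpace ℝ (Fin 3)) : |x 0 - y 0| ≤ dist x y :=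
  abs_le_of_sq_le_sq (by
    rw [dist_sq_fin_three]
    linarith [sq_nonneg (x 1 - y 1), sq_nonneg (x 2 - y 2)]) dist_nonneg 

lemma continuous_spPt (c ρ ε : ℝ) : Continuous (spPt c ρ ε) := by
  refine (PiLp.continuous_toLp 2 _).comp (continuous_pi fun i => ?_)
  fin_cases i <;> simp <;> fun_prop

lemma dist_spPt_le {c ρ ε B ψ ψ' : ℝ} (hε : 0 ≤ ε) (h : |ρ - ε * ψ| ≤ B)
    (h' : |ρ - ε * ψ'| ≤ B) :
    dist (spPt c ρ ε ψ) (spPt c ρ ε ψ') ≤ (ε + B) * |ψ - ψ'| := by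
  have hB : 0 ≤ B := (abs_nonneg _).trans h
  refine (sq_le_sq₀ dist_nonneg (by positivity)).1 ?_
  rw [dist_sq_fin_three, mul_pow, sq_abs]
  simp only [spPt_apply_zero, spPt_apply_one, spPt_apply_two]
  set r := ρ - ε * ψ with hr
  set r' := ρ - ε * ψ' with hr'
  have key : (c - c) ^ 2 + (r * cos ψ - r' * cos ψ') ^ 2 + (r * sin ψ - r' * sin ψ') ^ 2 =
      (r - r') ^ 2 + 2 * (r * r') * (1 - cos (ψ - ψ')) := by
    rw [cos_sub]
    linear_combination r ^ 2 * sin_sq_add_cos_sq ψ + r' ^ 2 * sin_sq_add_cos_sq ψ'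
  have h1 : r * r' ≤ B * B := by
    calc r * r' ≤ |r * r'| := le_abs_self _
      _ = |r| * |r'| := abs_mul _ _
      _ ≤ B * B := by gcongr
  have h2 : 0 ≤ 1 - cos (ψ - ψ') := by linarith [cos_le_one (ψ - ψ')]
  have h3 : 1 - cos (ψ - ψ') ≤ (ψ - ψ') ^ 2 / 2 := by
    linarith [Real.one_sub_sq_div_two_le_cos (x := ψ - ψ')]
  have h4 : r * r' * (1 - cos (ψ - ψ')) ≤ B * B * ((ψ - ψ') ^ 2 / 2) :=
    (mul_le_mul_of_nonneg_right h1 h2).trans (mul_le_mul_of_nonneg_left h3 (by positivity))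
  have h5 : (r - r') ^ 2 = ε ^ 2 * (ψ - ψ') ^ 2 := by rw [hr, hr']; ring
  rw [key, h5]
  nlinarith [mul_nonneg (mul_nonneg (sq_nonneg (ψ - ψ')) hε) hB]

/-- The arc `t ↦ spPt c ρ ε (L t)` of a spiral is not longer than `(ε + B) |L|`. -/
lemma eVariationOn_spPt_le {c ρ ε B L : ℝ} (hε : 0 ≤ ε)
    (h : ∀ t ∈ Icc (0:ℝ) 1, |ρ - ε * (L * t)| ≤ B) :
    eVariationOn (fun t => spPt c ρ ε (L * t)) (Icc 0 1) ≤ ENNReal.ofReal ((ε + B) * |L|) := by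
  have hB : 0 ≤ B := (abs_nonneg _).trans (h 0 ⟨le_rfl, zero_le_one⟩)
  have hK : 0 ≤ (ε + B) * |L| := by positivity
  have hlip : LipschitzOnWith ((ε + B) * |L|).toNNReal (fun t => spPt c ρ ε (L * t))
      (Icc 0 1) := by
    refine LipschitzOnWith.of_dist_le_mul fun x hx y hy => ?_
    rw [Real.coe_toNNReal _ hK]
    refine (dist_spPt_le hε (h x hx) (h y hy)).trans (le_of_eq ?_)
    rw [← mul_sub, abs_mul, Real.dist_eq, mul_assoc]
  have h1 := hlip.comp_eVariationOn_le (g := id) (s := Icc (0:ℝ) 1) (fun x hx => hx)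
  have h2 : eVariationOn (id : ℝ → ℝ) (Icc 0 1) ≤ 1 := by
    simp
  calc _ ≤ _ := h1
    _ ≤ _ * 1 := by gcongr
    _ = _ := by rw [mul_one]; rfl

lemma cos_sin_mul_eq {r r' ψ ψ' : ℝ} (hr : 0 < r) (hr' : 0 < r')
    (h1 : r * cos ψ = r' * cos ψ') (h2 : r * sin ψ = r' * sin ψ') :
    r = r' ∧ ∃ n : ℤ, ψ' = ψ + n * (2 * π) := by
  have hrr : r = r' := by
    have : r ^ 2 = r' ^ 2 := by
      linear_combination (r * cos ψ + r' * cos ψ') * h1 + (r * sin ψ + r' * sin ψ') * h2 -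
        r ^ 2 * sin_sq_add_cos_sq ψ + r' ^ 2 * sin_sq_add_cos_sq ψ'
    exact (pow_left_inj₀ hr.le hr'.le two_ne_zero).1 this
  subst hrr
  refine ⟨rfl, ?_⟩
  have hc := mul_left_cancel₀ hr.ne' h1
  have hs := mul_left_cancel₀ hr.ne' h2
  have h : cos (ψ' - ψ) = 1 := by
    rw [cos_sub, ← hc, ← hs]
    linarith [sin_sq_add_cos_sq ψ]
  obtain ⟨n, hn⟩ := (Real.cos_eq_one_iff _).1 h
  exact ⟨n, by linarith⟩

lemma spPt_mem_segment {c ρ ε ρ' ε' ψ ψ₁ ψ₂ w : ℝ} (hw0 : 0 ≤ w) (hw1 : w ≤ 1)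
    (hr : ρ' - ε' * ψ = (1 - w) * (ρ - ε * ψ₁) + w * (ρ - ε * ψ₂))
    (hc₁ : cos ψ₁ = cos ψ) (hs₁ : sin ψ₁ = sin ψ) (hc₂ : cos ψ₂ = cos ψ)
    (hs₂ : sin ψ₂ = sin ψ) :
    spPt c ρ' ε' ψ ∈ segment ℝ (spPt c ρ ε ψ₁) (spPt c ρ ε ψ₂) := by
  refine ⟨1 - w, w, by linarith, hw0, by ring, ?_⟩
  ext i
  fin_cases i
  · simp; ring
  · simp [hr, hc₁, hc₂]; ring
  · simp [hr, hs₁, hs₂]; ring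

/-- The labyrinth property fails for spirals without any turn. -/
lemma LabyrinthProp.ne_zero {c ρ ε : ℝ} {M : ℕ} (h : LabyrinthProp c ρ ε M) (hε : 0 < ε)
    (hρ : 0 < ρ) (hρ' : ρ ≤ 1 / 4) : M ≠ 0 := by
  rintro rfl
  set e : ℝ := min ε (ρ / 10) with he
  have he0 : 0 < e := lt_min hε (by linarith)
  have he1 : e ≤ ε := min_le_left _ _
  have he2 : e ≤ ρ / 10 := min_le_right _ _
  have hπ := pi_gt_three
  have hπ4 := pi_lt_four
  have hw : 0 ≤ e / (2 * ε) ∧ e / (2 * ε) ≤ 1 := by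
    refine ⟨by positivity, ?_⟩
    rw [div_le_one (by positivity)]
    linarith
  have hwe : e / (2 * ε) * (2 * ε) = e := by field_simp
  have hL := h (fun t => spPt c (ρ - e * π) e (-(2 * π) * t))
    ((continuous_spPt _ _ _).comp (by fun_prop)).continuousOn (fun t _ => rfl)
    (by
      simp only [mul_zero]
      refine spPt_mem_segment hw.1 hw.2 ?_ rfl rfl (by simp) (by simp)
      linear_combination π * hwe)
    (by
      simp only [mul_one, Nat.cast_zero, mul_zero, zero_sub, mul_neg]
      refine spPt_mem_segment (w := 1 - e / (2 * ε)) (by linarith) (by linarith) ?_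
        rfl rfl (by simp) (by simp)
      linear_combination (-π) * hwe)
    (by
      intro t ht ψ hψ heq
      have hψ0 : ψ = 0 := by
        have := hψ.2
        simp at this
        exact le_antisymm this hψ.1
      subst hψ0
      have h1 := congrArg (fun x : EuclideanSpace ℝ (Fin 3) => x 1) heq
      have h2 := congrArg (fun x : EuclideanSpace ℝ (Fin 3) => x 2) heq
      simp only [spPt_apply_one, spPt_apply_two] at h1 h2
      have ht1 := ht.1
      obtain ⟨h3, n, hn⟩ := cos_sin_mul_eq (by nlinarith [mul_nonneg he0.le ht1]) (by simpa) h1 h2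
      have h4 : e * (2 * π * t - π) = 0 := by linear_combination h3
      have h5 : 2 * π * t = π := by
        rcases mul_eq_zero.1 h4 with h | h
        · exact absurd h he0.ne'
        · linarith
      have h6 : (2 * (n:ℝ)) * π = 1 * π := by linear_combination -hn + h5
      have h7 : 2 * (n:ℝ) = 1 := mul_right_cancel₀ pi_ne_zero h6
      have h8 : 2 * n = 1 := by exact_mod_cast h7
      omega)
  have hU := eVariationOn_spPt_le (c := c) (ρ := ρ - e * π) (ε := e) (B := ρ + e * π)
    (L := -(2 * π)) he0.le (by
      intro t ht
      rw [abs_le]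
      have h1 : 0 ≤ e * π * t := mul_nonneg (by positivity) ht.1
      have h2 : e * π * t ≤ e * π * 1 := mul_le_mul_of_nonneg_left ht.2 (by positivity)
      constructor <;> nlinarith)
  have := (ENNReal.ofReal_le_ofReal_iff (by positivity)).1 (hL.trans hU)
  rw [abs_neg, abs_of_pos (by positivity)] at this
  nlinarith [mul_pos he0 pi_pos]

/-- The labyrinth property forces many turns: the corridor of the spiral has length at most
`2πρ(M - 1)`. -/
lemma LabyrinthProp.ten_le {c ρ ε : ℝ} {M : ℕ} (h : LabyrinthProp c ρ ε M) (hε : 0 < ε)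
    (hM : ε * (2 * π * M) < ρ) (hρ' : ρ ≤ 1 / 4) : 10 ≤ 2 * π * ρ * ((M:ℝ) - 1) := by
  have hπ := pi_gt_three
  have hρ : 0 < ρ := lt_of_le_of_lt (by positivity) hM
  have hM1 : (1:ℝ) ≤ M := by
    exact_mod_cast Nat.one_le_iff_ne_zero.2 (h.ne_zero hε hρ hρ')
  set L : ℝ := 2 * π * ((M:ℝ) - 1) with hLdef
  have hL0 : 0 ≤ L := mul_nonneg (by positivity) (by linarith)
  have hrad : ∀ t ∈ Icc (0:ℝ) 1, 0 ≤ L * t ∧ L * t ≤ L := fun t ht =>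
    ⟨mul_nonneg hL0 ht.1, by nlinarith [ht.2]⟩
  have hεπ : 0 < ε * π := by positivity
  have hLM : ε * L = ε * (2 * π * M) - 2 * (ε * π) := by rw [hLdef]; ring
  have hpos : ∀ t ∈ Icc (0:ℝ) 1, 0 < ρ - ε * π - ε * (L * t) := fun t ht => by
    have := mul_le_mul_of_nonneg_left (hrad t ht).2 hε.le
    linarith
  have hcos : cos L = 1 ∧ sin L = 0 := by
    have h1 : L = ((M - 1 : ℤ) : ℝ) * (2 * π) := by rw [hLdef]; push_cast; ring
    refine ⟨(Real.cos_eq_one_iff _).2 ⟨_, h1.symm⟩, ?_⟩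
    rw [Real.sin_eq_zero_iff]
    exact ⟨2 * (M - 1), by rw [h1]; push_cast; ring⟩
  have hV := h (fun t => spPt c (ρ - ε * π) ε (L * t))
    ((continuous_spPt _ _ _).comp (by fun_prop)).continuousOn (fun t _ => rfl)
    (by
      simp only [mul_zero]
      refine spPt_mem_segment (w := 1 / 2) (by norm_num) (by norm_num) ?_ rfl rfl
        (by simp) (by simp)
      ring)
    (by
      simp only [mul_one]
      have h2 : 2 * π * (M:ℝ) = L + 2 * π := by rw [hLdef]; ring
      rw [h2]
      refine spPt_mem_segment (w := 1 / 2) (by norm_num) (by norm_num) ?_ rfl rfl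
        (by simp) (by simp)
      ring)
    (by
      intro t ht ψ hψ heq
      have h1 := congrArg (fun x : EuclideanSpace ℝ (Fin 3) => x 1) heq
      have h2 := congrArg (fun x : EuclideanSpace ℝ (Fin 3) => x 2) heq
      simp only [spPt_apply_one, spPt_apply_two] at h1 h2
      obtain ⟨h3, n, hn⟩ := cos_sin_mul_eq (hpos t ht)
        (by have := mul_le_mul_of_nonneg_left hψ.2 hε.le; linarith) h1 h2
      have h4 : ε * (ψ - (L * t + π)) = 0 := by linear_combination h3
      have h5 : ψ = L * t + π := by
        rcases mul_eq_zero.1 h4 with h | h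
        · exact absurd h hε.ne'
        · linarith
      have h6 : (2 * (n:ℝ)) * π = 1 * π := by linear_combination -hn + h5
      have h7 : 2 * (n:ℝ) = 1 := mul_right_cancel₀ pi_ne_zero h6
      have h8 : 2 * n = 1 := by exact_mod_cast h7
      omega)
  have hU := eVariationOn_spPt_le (c := c) (ρ := ρ - ε * π) (ε := ε) (B := ρ - ε * π)
    (L := L) hε.le (by
      intro t ht
      rw [abs_of_pos (hpos t ht)]
      linarith [mul_nonneg hε.le (hrad t ht).1])
  have hεπ3 : ε ≤ ε * π := by nlinarith
  have := (ENNReal.ofReal_le_ofReal_iff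
    (mul_nonneg (by linarith [mul_nonneg hε.le hL0]) (abs_nonneg _))).1 (hV.trans hU)
  rw [abs_of_nonneg hL0] at this
  calc (10:ℝ) ≤ (ε + (ρ - ε * π)) * L := this
    _ ≤ ρ * L := mul_le_mul_of_nonneg_right (by linarith) hL0
    _ = _ := by rw [hLdef]; ring

/-- The angle `(2π)⁻ʲ π/6` between consecutive segments of level `j`. -/
noncomputable def angStep (j : ℕ) : ℝ := (2 * π) ^ (-(j : ℤ)) * (π / 6)

lemma angStep_pos (j : ℕ) : 0 < angStep j := by
  unfold angStep
  have := pi_pos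
  positivity

lemma angStep_eq (j : ℕ) : angStep j = 2 * π * angStep (j + 1) := by
  have := pi_pos
  simp only [angStep, zpow_neg, zpow_natCast, pow_succ]
  field_simp

lemma angJK_eq (j k : ℕ) : angJK j k = k * angStep j := by
  unfold angJK angStep
  ring

namespace validJK

variable {j k : ℕ}

lemma angJK_le (h : validJK j k) : angJK j k ≤ π / 6 := by
  have hπ := pi_pos
  have h1 : (k : ℝ) ≤ (2 * π) ^ j :=
    (Nat.cast_le.2 h.2.2).trans (Nat.floor_le (by positivity))
  have h2 : (k : ℝ) * (2 * π) ^ (-(j : ℤ)) ≤ 1 := by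
    rw [zpow_neg, zpow_natCast, ← div_eq_mul_inv, div_le_one (by positivity)]
    exact h1
  unfold angJK
  nlinarith

lemma angStep_le (h : validJK j k) : angStep j ≤ angJK j k := by
  have h1 : (1 : ℝ) ≤ k := by exact_mod_cast h.2.1
  rw [angJK_eq]
  nlinarith [angStep_pos j]

lemma angJK_pos (h : validJK j k) : 0 < angJK j k := (angStep_pos j).trans_le h.angStep_le

lemma cos_ge (h : validJK j k) : 43 / 50 ≤ cos (angJK j k) := by
  have h1 := cos_sq_ge_of_le h.angJK_pos.le h.angJK_le
  have h2 : 0 ≤ cos (angJK j k) :=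
    cos_nonneg_of_mem_Icc ⟨by linarith [h.angJK_pos, pi_pos], by linarith [h.angJK_le, pi_pos]⟩
  nlinarith

lemma cJK_ge (h : validJK j k) : 43 / 50 * (2:ℝ) ^ (-(j:ℤ)) ≤ cJK j k := by
  have : (0:ℝ) < (2:ℝ) ^ (-(j:ℤ)) := by positivity
  unfold cJK
  nlinarith [h.cos_ge]

lemma cJK_le (_ : validJK j k) : cJK j k ≤ (2:ℝ) ^ (-(j:ℤ)) := by
  have : (0:ℝ) < (2:ℝ) ^ (-(j:ℤ)) := by positivity
  unfold cJK
  nlinarith [cos_le_one (angJK j k)]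

lemma cJK_pos (h : validJK j k) : 0 < cJK j k := lt_of_lt_of_le (by positivity) h.cJK_ge

lemma rJK_pos (h : validJK j k) : 0 < rJK j k := by
  have : 0 < sin (angJK j k) :=
    sin_pos_of_pos_of_lt_pi h.angJK_pos (by linarith [h.angJK_le, pi_pos])
  unfold rJK
  positivity

lemma rJK_le (h : validJK j k) : rJK j k ≤ (2:ℝ) ^ (-(j:ℤ)) / 2 := by
  have : (0:ℝ) < (2:ℝ) ^ (-(j:ℤ)) := by positivity
  have h1 : sin (angJK j k) ≤ sin (π / 6) :=
    sin_le_sin_of_le_of_le_pi_div_two (by linarith [h.angJK_pos, pi_pos]) (by linarith [pi_pos])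
      h.angJK_le
  rw [sin_pi_div_six] at h1
  unfold rJK
  nlinarith

lemma two_zpow_le (h : validJK j k) : (2:ℝ) ^ (-(j:ℤ)) ≤ 1 / 2 := by
  rw [zpow_neg, zpow_natCast, one_div]
  exact inv_anti₀ two_pos (le_self_pow₀ one_le_two (by have := h.1; omega))

lemma rJK_le_quarter (h : validJK j k) : rJK j k ≤ 1 / 4 := by
  linarith [h.rJK_le, h.two_zpow_le]

lemma rJK_eq (h : validJK j k) : rJK j k = cJK j k * tan (angJK j k) := by
  have := h.cos_ge
  unfold rJK cJK
  rw [tan_eq_sin_div_cos]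
  field_simp

lemma angJK_le_tan (h : validJK j k) : angJK j k ≤ tan (angJK j k) := by
  have := sub_le_tan_sub_tan le_rfl h.angJK_pos.le h.angJK_le
  simpa using this

lemma tan_le_one (h : validJK j k) : tan (angJK j k) ≤ 1 := by
  have := tan_sub_tan_le le_rfl h.angJK_pos.le h.angJK_le
  rw [tan_zero] at this
  linarith [h.angJK_le, pi_lt_four]

end validJK

lemma two_zpow_neg_succ (j : ℕ) : (2:ℝ) ^ (-((j + 1 : ℕ):ℤ)) = (2:ℝ) ^ (-(j:ℤ)) / 2 := by
  simp only [zpow_neg, zpow_natCast, pow_succ]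
  field_simp

lemma mem_spiralStrip {c ρ ε ψ : ℝ} {M : ℕ} {y : EuclideanSpace ℝ (Fin 3)} (hc : 0 < c)
    (hy0 : c ≤ y 0) (hy0' : y 0 ≤ 11 * c) (hψ : ψ ∈ Icc 0 (2 * π * M))
    (hy1 : y 1 = y 0 * ((ρ - ε * ψ) / c) * cos ψ) (hy2 : y 2 = y 0 * ((ρ - ε * ψ) / c) * sin ψ) :
    y ∈ spiralStrip c ρ ε M := by
  refine ⟨ψ, hψ, y 0 / c, ⟨?_, ?_⟩, ?_⟩
  · rwa [le_div_iff₀ hc, one_mul]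
  · rwa [div_le_iff₀ hc]
  · ext i
    fin_cases i
    · simp
      field_simp
    · simp [hy1]
      field_simp
    · simp [hy2]
      field_simp

/-- A family of disjoint spiral strips with the labyrinth property. -/
structure StripSystem (ε : ℕ → ℕ → ℝ) (M : ℕ → ℕ → ℕ) : Prop where
  pos : ∀ j k, validJK j k → 0 < ε j k
  small : ∀ j k, validJK j k → ε j k * (2 * π * M j k) < rJK j k
  labyrinth : ∀ j k, validJK j k → LabyrinthProp (cJK j k) (rJK j k) (ε j k) (M j k)
  disjoint : ∀ j k i l, validJK j k → validJK i l → (j, k) ≠ (i, l) →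
    Disjoint (spiralStrip (cJK j k) (rJK j k) (ε j k) (M j k))
      (spiralStrip (cJK i l) (rJK i l) (ε i l) (M i l))

/-- The rotation angle of the part of a strip which is used to bound lengths from below. -/
noncomputable def turn (j k : ℕ) : ℝ := 24 / 5 / rJK j k + 5 * π / 2

/-- The decrease of the slope of a strip while it rotates by `turn j k`. -/
noncomputable def slopeWidth (ε : ℕ → ℕ → ℝ) (j k : ℕ) : ℝ := ε j k / cJK j k * turn j k

namespace StripSystem

variable {ε : ℕ → ℕ → ℝ} {M : ℕ → ℕ → ℕ} {j k : ℕ}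

lemma le_turns (hS : StripSystem ε M) (h : validJK j k) :
    10 / rJK j k + 2 * π ≤ 2 * π * M j k := by
  have h1 := (hS.labyrinth j k h).ten_le (hS.pos j k h) (hS.small j k h) h.rJK_le_quarter
  have : 10 / rJK j k ≤ 2 * π * (M j k - 1) := by
    rw [div_le_iff₀ h.rJK_pos]
    linarith
  linarith

lemma four_le_inv (h : validJK j k) : 4 ≤ 1 / rJK j k := by
  rw [le_div_iff₀ h.rJK_pos]
  linarith [h.rJK_le_quarter]

lemma turn_eq (j k : ℕ) : turn j k = 24 / 5 * (1 / rJK j k) + 5 * π / 2 := by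
  unfold turn; ring

lemma turn_pos (h : validJK j k) : 0 < turn j k := by
  rw [turn_eq]
  linarith [four_le_inv h, pi_pos]

lemma turn_add_le (hS : StripSystem ε M) (h : validJK j k) :
    turn j k + 6 * π ≤ 2 * π * M j k := by
  have h1 := hS.le_turns h
  have h2 := four_le_inv h
  have h3 : 10 / rJK j k = 10 * (1 / rJK j k) := by ring
  rw [turn_eq]
  linarith [pi_lt_d2]

/-- Strips of consecutive levels do not meet in a common plane orthogonal to the axis. -/
lemma tan_sub_ne (hS : StripSystem ε M) {k' n : ℕ} {ψ : ℝ} (h : validJK j k)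
    (h' : validJK (j + 1) k') (hψ0 : 0 ≤ ψ) (hψ' : ψ ≤ 2 * π * M (j + 1) k')
    (hψ : ψ + n * (2 * π) ≤ 2 * π * M j k) :
    tan (angJK j k) - ε j k / cJK j k * (ψ + n * (2 * π)) ≠
      tan (angJK (j + 1) k') - ε (j + 1) k' / cJK (j + 1) k' * ψ := by
  intro heq
  have hc := h.cJK_pos
  have hc' := h'.cJK_pos
  have hπ := pi_pos
  have e1 : (rJK j k - ε j k * (ψ + n * (2 * π))) / cJK j k =
      tan (angJK j k) - ε j k / cJK j k * (ψ + n * (2 * π)) := by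
    rw [h.rJK_eq]
    field_simp
  have e2 : (rJK (j + 1) k' - ε (j + 1) k' * ψ) / cJK (j + 1) k' =
      tan (angJK (j + 1) k') - ε (j + 1) k' / cJK (j + 1) k' * ψ := by
    rw [h'.rJK_eq]
    field_simp
  have hb1 := h.cJK_ge
  have hb2 := h.cJK_le
  have hb1' := h'.cJK_ge
  have hb2' := h'.cJK_le
  have hs : (0:ℝ) < (2:ℝ) ^ (-(j:ℤ)) := by positivity
  rw [two_zpow_neg_succ] at hb1' hb2'
  set y := spPt (cJK j k) (rJK j k) (ε j k) (ψ + n * (2 * π)) with hy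
  have hy0 : y 0 = cJK j k := rfl
  have hy1 : y 1 = (rJK j k - ε j k * (ψ + n * (2 * π))) * cos ψ := by
    rw [hy, spPt_apply_one, cos_add_nat_mul_two_pi]
  have hy2 : y 2 = (rJK j k - ε j k * (ψ + n * (2 * π))) * sin ψ := by
    rw [hy, spPt_apply_two, sin_add_nat_mul_two_pi]
  refine Set.disjoint_left.1 (hS.disjoint j k (j + 1) k' h h' (by simp))
    (show y ∈ _ from ⟨_, ⟨by positivity, hψ⟩, 1, by norm_num, (one_smul _ _).symm⟩)
    (mem_spiralStrip (ψ := ψ) hc' ?_ ?_ ⟨hψ0, hψ'⟩ ?_ ?_)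
  · rw [hy0]; linarith
  · rw [hy0]; linarith
  · rw [hy0, hy1, e2, ← heq, ← e1]; field_simp
  · rw [hy0, hy2, e2, ← heq, ← e1]; field_simp

lemma slope_lt (hS : StripSystem ε M) (h : validJK j k) :
    ε j k / cJK j k < (2:ℝ) ^ (-(j:ℤ)) / 20 := by
  have hρ := h.rJK_pos
  have hc := h.cJK_pos
  have hε := hS.pos j k h
  have h1 := hS.le_turns h
  have h2 := hS.small j k h
  have h3 : ε j k * (10 / rJK j k) < rJK j k := by nlinarith [pi_pos]
  have h4 : ε j k * 10 < rJK j k * rJK j k := by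
    rwa [mul_div_assoc', div_lt_iff₀ hρ] at h3
  rw [div_lt_iff₀ hc]
  have h5 := h.rJK_le
  have h6 : rJK j k ≤ cJK j k := by
    rw [h.rJK_eq]
    nlinarith [h.tan_le_one]
  nlinarith

lemma exists_wide_succ (hS : StripSystem ε M) (h : validJK j k)
    (hw : 4 / 3 * angStep (j + 1) < slopeWidth ε j k) :
    ∃ k', validJK (j + 1) k' ∧ 4 / 3 * angStep (j + 2) < slopeWidth ε (j + 1) k' ∧
      2 / 3 * (ε j k / cJK j k) ≤ ε (j + 1) k' / cJK (j + 1) k' := by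
  have hπ := pi_gt_three
  have hk : (1:ℝ) ≤ k := by exact_mod_cast h.2.1
  obtain ⟨k', hk'⟩ : ∃ k', ⌈2 * π * k⌉₊ = k' + 1 :=
    Nat.exists_eq_succ_of_ne_zero (Nat.ceil_pos.2 (by positivity)).ne'
  have hle : 2 * π * k ≤ k' + 1 := by
    have := Nat.le_ceil (2 * π * k)
    rw [hk'] at this
    exact_mod_cast this
  have hlt : k' < 2 * π * k := by
    have := Nat.ceil_lt_add_one (show 0 ≤ 2 * π * k by positivity)
    rw [hk'] at this
    push_cast at this
    linarith
  have hv : validJK (j + 1) k' := by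
    refine ⟨by omega, ?_, ?_⟩
    · have : (0:ℝ) < k' := by nlinarith
      exact_mod_cast this
    · refine Nat.le_floor (hlt.le.trans ?_)
      have h1 : (k : ℝ) ≤ (2 * π) ^ j :=
        (Nat.cast_le.2 h.2.2).trans (Nat.floor_le (by positivity))
      rw [pow_succ]
      nlinarith
  have hU := angStep_pos (j + 1)
  have hang : angJK j k = 2 * π * k * angStep (j + 1) := by
    rw [angJK_eq, angStep_eq]; ring
  have hang' : angJK (j + 1) k' = k' * angStep (j + 1) := angJK_eq _ _
  have hlt' : angJK (j + 1) k' < angJK j k := by rw [hang, hang']; nlinarith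
  have hle' : angJK j k - angJK (j + 1) k' ≤ angStep (j + 1) := by
    rw [hang, hang']; nlinarith
  have ht1 := sub_le_tan_sub_tan hv.angJK_pos.le hlt'.le h.angJK_le
  have ht2 := tan_sub_tan_le hv.angJK_pos.le hlt'.le h.angJK_le
  have hb : 0 < ε j k / cJK j k := div_pos (hS.pos j k h) h.cJK_pos
  have hb' : 0 < ε (j + 1) k' / cJK (j + 1) k' := div_pos (hS.pos _ _ hv) hv.cJK_pos
  have hslope : 2 / 3 * (ε j k / cJK j k) ≤ ε (j + 1) k' / cJK (j + 1) k' := by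
    by_contra! hcon
    unfold slopeWidth at hw
    set b := ε j k / cJK j k
    set b' := ε (j + 1) k' / cJK (j + 1) k'
    set a := tan (angJK j k)
    set a' := tan (angJK (j + 1) k')
    set n := ⌊(a - a') / (2 * π * b)⌋₊
    have hb2 : 0 < 2 * π * b := by positivity
    have hn1 : n * (2 * π * b) ≤ a - a' := by
      rw [← le_div_iff₀ hb2]
      exact Nat.floor_le (div_nonneg (by linarith) hb2.le)
    have hn2 : a - a' < (n + 1) * (2 * π * b) := by
      rw [← div_lt_iff₀ hb2]
      exact Nat.lt_floor_add_one _
    have hn3 : n * (2 * π) < turn j k := by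
      have : b * (n * (2 * π)) < b * turn j k := by linarith
      exact lt_of_mul_lt_mul_left this hb.le
    obtain ⟨ψ, hψ, hF⟩ := intermediate_value_Icc' (show (0:ℝ) ≤ 6 * π by positivity)
      (f := fun ψ => a - b * (ψ + n * (2 * π)) - (a' - b' * ψ)) (by fun_prop)
      (show (0:ℝ) ∈ _ from ⟨by nlinarith, by linarith⟩)
    have h1 := hS.turn_add_le h
    have h2 := hS.turn_add_le hv
    have h3 := turn_pos hv
    exact hS.tan_sub_ne (n := n) h hv hψ.1 (by linarith [hψ.2]) (by linarith [hψ.2])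
      (by linarith [hF])
  refine ⟨k', hv, ?_, hslope⟩
  have hr : rJK (j + 1) k' ≤ rJK j k := by
    have : sin (angJK (j + 1) k') ≤ sin (angJK j k) :=
      sin_le_sin_of_le_of_le_pi_div_two (by linarith [hv.angJK_pos]) (by linarith [h.angJK_le])
        hlt'.le
    have h0 : 0 < rJK (j + 1) k' := hv.rJK_pos
    have hs : (0:ℝ) < (2:ℝ) ^ (-(j:ℤ)) := by positivity
    unfold rJK at h0 ⊢
    rw [two_zpow_neg_succ] at h0 ⊢
    nlinarith
  have hturn : turn j k ≤ turn (j + 1) k' := by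
    rw [turn_eq, turn_eq]
    have := one_div_le_one_div_of_le hv.rJK_pos hr
    linarith
  have hU2 := angStep_eq (j + 1)
  have hU2' := angStep_pos (j + 2)
  have h1 : 2 / 3 * slopeWidth ε j k ≤ slopeWidth ε (j + 1) k' := by
    unfold slopeWidth
    rw [← mul_assoc]
    exact mul_le_mul hslope hturn (turn_pos h).le hb'.le
  nlinarith

lemma slopeWidth_le (hS : StripSystem ε M) (h : validJK j k) :
    slopeWidth ε j k ≤ 4 / 3 * angStep (j + 1) := by
  by_contra! hw
  have hb : 0 < ε j k / cJK j k := div_pos (hS.pos j k h) h.cJK_pos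
  have key : ∀ i : ℕ, ∃ k', validJK (j + i) k' ∧
      4 / 3 * angStep (j + i + 1) < slopeWidth ε (j + i) k' ∧
      (2 / 3) ^ i * (ε j k / cJK j k) ≤ ε (j + i) k' / cJK (j + i) k' := by
    intro i
    induction i with
    | zero => exact ⟨k, h, hw, by simp⟩
    | succ i ih =>
      obtain ⟨k', hv, hw', hb'⟩ := ih
      obtain ⟨k'', hv', hw'', hb''⟩ := hS.exists_wide_succ hv hw'
      refine ⟨k'', hv', hw'', le_trans ?_ hb''⟩
      rw [pow_succ]
      linarith
  obtain ⟨i, hi⟩ := pow_unbounded_of_one_lt (1 / (ε j k / cJK j k))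
    (show (1:ℝ) < 4 / 3 by norm_num)
  obtain ⟨k', hv, -, hb'⟩ := key i
  have h1 := hb'.trans_lt (hS.slope_lt hv)
  have h2 : (2:ℝ) ^ (-((j + i : ℕ):ℤ)) ≤ (1 / 2) ^ i := by
    rw [zpow_neg, zpow_natCast, one_div, inv_pow]
    exact inv_anti₀ (by positivity) (pow_le_pow_right₀ one_le_two (by omega))
  have h3 : (4 / 3 : ℝ) ^ i * (1 / 2) ^ i = (2 / 3) ^ i := by
    rw [← mul_pow]; norm_num
  rw [div_lt_iff₀ hb] at hi
  have h4 : (0:ℝ) < (1 / 2) ^ i := by positivity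
  have h5 : (1 / 2 : ℝ) ^ i < (2 / 3) ^ i * (ε j k / cJK j k) := by
    rw [← h3]
    nlinarith
  linarith

end StripSystem

/-- The tangent of the angle between a point and the axis. -/
noncomputable def slope3 (x : EuclideanSpace ℝ (Fin 3)) : ℝ := √(x 1 ^ 2 + x 2 ^ 2) / x 0

lemma continuousOn_slope3 {γ : ℝ → EuclideanSpace ℝ (Fin 3)} {s : Set ℝ}
    (hγ : ContinuousOn γ s) (hX : ∀ t ∈ s, 0 < γ t 0) :
    ContinuousOn (fun t => slope3 (γ t)) s := by
  have h (i : Fin 3) : ContinuousOn (fun t => γ t i) s :=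
    (EuclideanSpace.proj (𝕜 := ℝ) i).continuous.comp_continuousOn hγ
  exact ContinuousOn.div (((h 1).pow 2).add ((h 2).pow 2)).sqrt (h 0) fun t ht => (hX t ht).ne.symm

/-- An angular coordinate around the axis along a curve `γ` which avoids the half-lines at angles
`ψ t`, taken in `[ψ t, ψ t + 2π]`. -/
lemma exists_angle {γ : ℝ → EuclideanSpace ℝ (Fin 3)} {s : Set ℝ} {r ψ : ℝ → ℝ}
    (hγ : ContinuousOn γ s) (hψ : ContinuousOn ψ s) (hr : ∀ t ∈ s, 0 < r t)
    (hrsq : ∀ t ∈ s, γ t 1 ^ 2 + γ t 2 ^ 2 = r t ^ 2)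
    (havoid : ∀ t ∈ s, ¬(γ t 1 = r t * cos (ψ t) ∧ γ t 2 = r t * sin (ψ t))) :
    ∃ g : ℝ → ℝ, ContinuousOn g s ∧ ∀ t ∈ s, g t ∈ Icc (ψ t) (ψ t + 2 * π) ∧
      γ t 1 = r t * cos (g t) ∧ γ t 2 = r t * sin (g t) := by
  have h (i : Fin 3) : ContinuousOn (fun t => γ t i) s :=
    (EuclideanSpace.proj (𝕜 := ℝ) i).continuous.comp_continuousOn hγ
  set A : ℝ → ℝ := fun t => -(γ t 1 * cos (ψ t) + γ t 2 * sin (ψ t)) with hA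
  set B : ℝ → ℝ := fun t => γ t 1 * sin (ψ t) - γ t 2 * cos (ψ t) with hB
  have hAc : ContinuousOn A s := by fun_prop
  have hBc : ContinuousOn B s := by fun_prop
  set v : ℝ → ℂ := fun t => (A t : ℂ) + B t * Complex.I with hv
  have hvc : ContinuousOn v s := by
    have h1 := Complex.continuous_ofReal.comp_continuousOn hAc
    have h2 := Complex.continuous_ofReal.comp_continuousOn hBc
    exact h1.add (h2.mul continuousOn_const)
  have hre : ∀ t, (v t).re = A t := fun t => by simp [hv]
  have him : ∀ t, (v t).im = B t := fun t => by simp [hv]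
  have hnorm : ∀ t ∈ s, ‖v t‖ = r t := fun t ht => by
    rw [← pow_left_inj₀ (norm_nonneg _) (hr t ht).le two_ne_zero, ← Complex.normSq_eq_norm_sq,
      Complex.normSq_apply, hre, him, ← hrsq t ht]
    simp only [hA, hB]
    linear_combination (γ t 1 ^ 2 + γ t 2 ^ 2) * sin_sq_add_cos_sq (ψ t)
  have hcos : ∀ t ∈ s, A t = r t * cos (v t).arg := fun t ht => by
    rw [← hre, ← hnorm t ht, Complex.norm_mul_cos_arg]
  have hsin : ∀ t ∈ s, B t = r t * sin (v t).arg := fun t ht => by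
    rw [← him, ← hnorm t ht, Complex.norm_mul_sin_arg]
  have h1 : ∀ t ∈ s, γ t 1 = r t * cos (ψ t + π + (v t).arg) := fun t ht => by
    have e1 := hcos t ht
    have e2 := hsin t ht
    simp only [hA, hB] at e1 e2
    rw [show ψ t + π + (v t).arg = ψ t + (v t).arg + π by ring, cos_add_pi, cos_add]
    linear_combination -(cos (ψ t)) * e1 + sin (ψ t) * e2 - γ t 1 * sin_sq_add_cos_sq (ψ t)
  have h2 : ∀ t ∈ s, γ t 2 = r t * sin (ψ t + π + (v t).arg) := fun t ht => by
    have e1 := hcos t ht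
    have e2 := hsin t ht
    simp only [hA, hB] at e1 e2
    rw [show ψ t + π + (v t).arg = ψ t + (v t).arg + π by ring, sin_add_pi, sin_add]
    linear_combination -(sin (ψ t)) * e1 - cos (ψ t) * e2 - γ t 2 * sin_sq_add_cos_sq (ψ t)
  have hslit : ∀ t ∈ s, v t ∈ Complex.slitPlane := fun t ht => by
    rw [Complex.mem_slitPlane_iff_arg]
    refine ⟨fun harg => havoid t ht ?_, fun h0 => ?_⟩
    · have e1 := h1 t ht
      have e2 := h2 t ht
      rw [harg, add_assoc, ← two_mul] at e1 e2
      rw [cos_add_two_pi] at e1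
      rw [sin_add_two_pi] at e2
      exact ⟨e1, e2⟩
    · have := hnorm t ht
      rw [h0, norm_zero] at this
      exact (hr t ht).ne this
  refine ⟨fun t => ψ t + π + (v t).arg, (hψ.add continuousOn_const).add
    fun t ht => (Complex.continuousAt_arg (hslit t ht)).comp_continuousWithinAt (hvc t ht),
    fun t ht => ⟨⟨?_, ?_⟩, h1 t ht, h2 t ht⟩⟩
  · linarith [Complex.neg_pi_lt_arg (v t)]
  · linarith [Complex.arg_le_pi (v t)]

lemma mul_le_dist_of_quarter_turn {x y : EuclideanSpace ℝ (Fin 3)} {s R R' φ φ' : ℝ} (hs : 0 ≤ s)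
    (hR : s ≤ R) (hR' : s ≤ R') (hφ : φ - φ' = π / 2) (hx1 : x 1 = R * cos φ)
    (hx2 : x 2 = R * sin φ) (hy1 : y 1 = R' * cos φ') (hy2 : y 2 = R' * sin φ') :
    1414 / 1000 * s ≤ dist x y := by
  obtain rfl : φ' = φ - π / 2 := by linarith
  rw [cos_sub_pi_div_two] at hy1
  rw [sin_sub_pi_div_two] at hy2
  have hd : dist x y ^ 2 = (x 0 - y 0) ^ 2 + (R ^ 2 + R' ^ 2) := by
    rw [dist_sq_fin_three, hx1, hx2, hy1, hy2]
    linear_combination (R ^ 2 + R' ^ 2) * sin_sq_add_cos_sq φ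
  refine (sq_le_sq₀ (by positivity) dist_nonneg).1 ?_
  have h1 := pow_le_pow_left₀ hs hR 2
  have h2 := pow_le_pow_left₀ hs hR' 2
  rw [hd, mul_pow]
  linarith [sq_nonneg (x 0 - y 0), sq_nonneg s]

namespace StripSystem

variable {ε : ℕ → ℕ → ℝ} {M : ℕ → ℕ → ℕ} {j k : ℕ}

lemma slopeWidth_le_mul_tan (hS : StripSystem ε M) (h : validJK j k) :
    slopeWidth ε j k ≤ 213 / 1000 * tan (angJK j k) := by
  have h1 := hS.slopeWidth_le h
  have h2 := h.angStep_le
  have h3 := h.angJK_le_tan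
  have h4 := angStep_eq j
  have h5 := angStep_pos (j + 1)
  nlinarith [pi_gt_d2]

lemma ten_thirds_le_eVariationOn (hS : StripSystem ε M) (h : validJK j k)
    {γ : ℝ → EuclideanSpace ℝ (Fin 3)} {p q : ℝ} (hpq : p ≤ q) (hγ : ContinuousOn γ (Icc p q))
    (hp : slope3 (γ p) = tan (angJK j k) - slopeWidth ε j k)
    (hq : slope3 (γ q) = tan (angJK j k))
    (hslope : ∀ t ∈ Icc p q,
      slope3 (γ t) ∈ Icc (tan (angJK j k) - slopeWidth ε j k) (tan (angJK j k)))
    (hX : ∀ t ∈ Icc p q, γ t 0 ∈ Icc (cJK j k) (11 * cJK j k))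
    (havoid : ∀ t ∈ Icc p q, γ t ∉ spiralStrip (cJK j k) (rJK j k) (ε j k) (M j k)) :
    ENNReal.ofReal (10 / 3) ≤ eVariationOn γ (Icc p q) := by
  have hw := hS.slopeWidth_le_mul_tan h
  have hc := h.cJK_pos
  have hρ := h.rJK_pos
  have hρa := h.rJK_eq
  have ha : 0 < tan (angJK j k) := h.angJK_pos.trans_le h.angJK_le_tan
  have hb : 0 < ε j k / cJK j k := div_pos (hS.pos j k h) hc
  have hwdef : slopeWidth ε j k = ε j k / cJK j k * turn j k := rfl
  set a := tan (angJK j k)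
  set b := ε j k / cJK j k with hbdef
  set c := cJK j k
  set ρ := rJK j k
  have hπ := pi_gt_d2
  have hπ' := pi_lt_d2
  have hXpos : ∀ t ∈ Icc p q, 0 < γ t 0 := fun t ht => hc.trans_le (hX t ht).1
  have hr : ∀ t ∈ Icc p q, 787 / 1000 * ρ ≤ γ t 0 * slope3 (γ t) := fun t ht => by
    have h1 := (hX t ht).1
    have h2 := (hslope t ht).1
    calc 787 / 1000 * ρ = c * (787 / 1000 * a) := by rw [hρa]; ring
      _ ≤ _ := mul_le_mul h1 (by linarith) (by positivity) (hXpos t ht).le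
  have hψ : ∀ t ∈ Icc p q, (a - slope3 (γ t)) / b ∈ Icc 0 (turn j k) := fun t ht => by
    have h1 := hslope t ht
    rw [hwdef] at h1
    exact ⟨div_nonneg (by linarith [h1.2]) hb.le, by rw [div_le_iff₀ hb]; linarith [h1.1]⟩
  have hcont := continuousOn_slope3 hγ hXpos
  obtain ⟨g, hg, hgt⟩ := exists_angle (r := fun t => γ t 0 * slope3 (γ t))
    (ψ := fun t => (a - slope3 (γ t)) / b) hγ (by fun_prop)
    (fun t ht => lt_of_lt_of_le (by positivity) (hr t ht))
    (fun t ht => by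
      have := (hXpos t ht).ne'
      rw [slope3, mul_div_cancel₀ _ this, Real.sq_sqrt (by positivity)])
    (fun t ht hcon => havoid t ht (by
      have h1 := hS.turn_add_le h
      have h2 := hψ t ht
      have h3 : (ρ - ε j k * ((a - slope3 (γ t)) / b)) / c = slope3 (γ t) := by
        have := (hS.pos j k h).ne'
        rw [hρa, hbdef]
        field_simp
        ring
      refine mem_spiralStrip (ψ := (a - slope3 (γ t)) / b) hc (hX t ht).1 (hX t ht).2
        ⟨h2.1, by linarith [h2.2]⟩ ?_ ?_
      · rw [h3]; exact hcon.1
      · rw [h3]; exact hcon.2))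
  set n := ⌊48 / 5 / (π * ρ) + 1⌋₊ with hn
  have hn1 : (n:ℝ) ≤ 48 / 5 / (π * ρ) + 1 := Nat.floor_le (by positivity)
  have hn2 : 48 / 5 / (π * ρ) ≤ n := by
    have := Nat.lt_floor_add_one (48 / 5 / (π * ρ) + 1)
    linarith
  have hpm := left_mem_Icc.2 hpq
  have hqm := right_mem_Icc.2 hpq
  have hV := ofReal_mul_le_eVariationOn_of_decrease γ g (δ := π / 2)
    (r := 1414 / 1000 * (787 / 1000 * ρ)) (by positivity) (by positivity) n hpq hg
    (fun u hu v hv huv => by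
      obtain ⟨-, hu1, hu2⟩ := hgt u hu
      obtain ⟨-, hv1, hv2⟩ := hgt v hv
      exact mul_le_dist_of_quarter_turn (by positivity) (hr u hu) (hr v hv) huv hu1 hu2 hv1 hv2)
    (by
      have h1 := (hgt p hpm).1.1
      have h2 := (hgt q hqm).1.2
      simp only [hp, hq, hwdef] at h1 h2
      have h3 : (a - (a - b * turn j k)) / b = turn j k := by field_simp; ring
      rw [h3] at h1
      rw [sub_self, zero_div] at h2
      have h4 : turn j k = 24 / 5 / ρ + 5 * π / 2 := rfl
      have h5 : (48 / 5 / (π * ρ) + 1) * (π / 2) = 24 / 5 / ρ + π / 2 := by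
        field_simp; ring
      nlinarith)
  refine (ENNReal.ofReal_le_ofReal ?_).trans hV
  have h1 : 48 / 5 / (π * ρ) * (1414 / 1000 * (787 / 1000 * ρ)) ≤
      n * (1414 / 1000 * (787 / 1000 * ρ)) := by gcongr
  refine le_trans ?_ h1
  rw [show 48 / 5 / (π * ρ) * (1414 / 1000 * (787 / 1000 * ρ)) =
    48 / 5 * (1414 / 1000) * (787 / 1000) / π by field_simp, le_div_iff₀ (by positivity)]
  linarith

end StripSystem

/-- A curve in the open half-space around the axis which avoids all spiral strips. -/
structure AvoidingCurve (ε : ℕ → ℕ → ℝ) (M : ℕ → ℕ → ℕ) (γ : ℝ → EuclideanSpace ℝ (Fin 3)) :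
    Prop where
  continuousOn : ContinuousOn γ (Icc 0 1)
  pos : ∀ t ∈ Icc (0:ℝ) 1, 0 < γ t 0
  avoid : ∀ t ∈ Icc (0:ℝ) 1, ∀ j k, validJK j k →
    γ t ∉ spiralStrip (cJK j k) (rJK j k) (ε j k) (M j k)

namespace StripSystem

variable {ε : ℕ → ℕ → ℝ} {M : ℕ → ℕ → ℕ} {j k : ℕ} {γ : ℝ → EuclideanSpace ℝ (Fin 3)}

lemma tan_le_tan_sub_slopeWidth (hS : StripSystem ε M) (h : validJK j k) {x : ℝ} (hx : 0 ≤ x)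
    (hd : x + 4 / 3 * angStep (j + 1) ≤ angJK j k) :
    tan x ≤ tan (angJK j k) - slopeWidth ε j k := by
  have h1 := hS.slopeWidth_le h
  have h2 := angStep_pos (j + 1)
  have h3 := sub_le_tan_sub_tan hx (by linarith) h.angJK_le
  linarith

lemma four_thirds_angStep_succ_le (j : ℕ) : 4 / 3 * angStep (j + 1) ≤ angStep j := by
  have := angStep_eq j
  have := angStep_pos (j + 1)
  nlinarith [pi_gt_three]

lemma slopeWidth_nonneg (hS : StripSystem ε M) (h : validJK j k) : 0 ≤ slopeWidth ε j k :=
  mul_nonneg (div_pos (hS.pos j k h) h.cJK_pos).le (turn_pos h).le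

/-- A curve crossing the slopes of a strip passes below the strip, or above it, or is long. -/
lemma crossing (hS : StripSystem ε M) (hA : AvoidingCurve ε M γ) (h : validJK j k) {s e : ℝ}
    (hs : 0 ≤ s) (hse : s ≤ e) (he : e ≤ 1)
    (hslope : slope3 (γ s) ≤ tan (angJK j k) - slopeWidth ε j k)
    (hslope' : tan (angJK j k) ≤ slope3 (γ e)) :
    ∃ q, s ≤ q ∧ q ≤ e ∧ slope3 (γ q) = tan (angJK j k) ∧
      ((∃ t, s ≤ t ∧ t ≤ q ∧ γ t 0 < cJK j k ∧ slope3 (γ t) ≤ tan (angJK j k) ∧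
          tan (angJK j k) - slopeWidth ε j k ≤ slope3 (γ t)) ∨
        (∃ t, s ≤ t ∧ t ≤ q ∧ 11 * cJK j k < γ t 0) ∨
        ENNReal.ofReal (10 / 3) ≤ eVariationOn γ (Icc s q)) := by
  have hsub : Icc s e ⊆ Icc 0 1 := Icc_subset_Icc hs he
  obtain ⟨p, q, hsp, hpq, hqe, hfp, hfq, hf⟩ := exists_crossing hse
    ((continuousOn_slope3 hA.continuousOn hA.pos).mono hsub) hslope
    (by linarith [hS.slopeWidth_nonneg h]) hslope'
  refine ⟨q, hsp.trans hpq, hqe, hfq, ?_⟩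
  by_cases hlow : ∃ t ∈ Icc p q, γ t 0 < cJK j k
  · obtain ⟨t, ht, hX⟩ := hlow
    exact Or.inl ⟨t, hsp.trans ht.1, ht.2, hX, (hf t ht).2, (hf t ht).1⟩
  by_cases hhigh : ∃ t ∈ Icc p q, 11 * cJK j k < γ t 0
  · obtain ⟨t, ht, hX⟩ := hhigh
    exact Or.inr (Or.inl ⟨t, hsp.trans ht.1, ht.2, hX⟩)
  push Not at hlow hhigh
  have hsub' : Icc p q ⊆ Icc 0 1 := (Icc_subset_Icc hsp hqe).trans hsub
  refine Or.inr (Or.inr (ofReal_le_eVariationOn_of_subset γ hsp le_rfl le_rfl ?_))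
  exact hS.ten_thirds_le_eVariationOn h hpq (hA.continuousOn.mono hsub') hfp hfq hf
    (fun t ht => ⟨hlow t ht, hhigh t ht⟩) (fun t ht => hA.avoid t (hsub' ht) j k h)

/-- A curve which goes from below a strip to below another strip of the same level is long. -/
lemma gap (hS : StripSystem ε M) (hA : AvoidingCurve ε M γ) {J : ℕ}
    (hJ : ∀ t ∈ Icc (0:ℝ) 1, (2:ℝ) ^ (-(J:ℤ)) ≤ γ t 0) (n : ℕ) {j k k' : ℕ} (hn : J ≤ j + n)
    (h : validJK j k) (h' : validJK j k') (hkk' : k < k') {t₁ t₂ : ℝ} (ht₁ : 0 ≤ t₁)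
    (ht : t₁ ≤ t₂) (ht₂ : t₂ ≤ 1) (hs₁ : slope3 (γ t₁) ≤ tan (angJK j k))
    (hX₁ : γ t₁ 0 < cJK j k)
    (hs₂ : tan (angJK j k') - slopeWidth ε j k' ≤ slope3 (γ t₂)) (hX₂ : γ t₂ 0 < cJK j k') :
    ENNReal.ofReal (20 / 3 * (2:ℝ) ^ (-(j:ℤ))) ≤ eVariationOn γ (Icc t₁ t₂) := by
  induction n generalizing j k k' t₁ t₂ with
  | zero =>
    have h1 := hJ t₁ ⟨ht₁, ht.trans ht₂⟩
    have h2 : (2:ℝ) ^ (-(j:ℤ)) ≤ (2:ℝ) ^ (-(J:ℤ)) := zpow_le_zpow_right₀ one_le_two (by omega)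
    linarith [h.cJK_le]
  | succ n ih =>
    have hsp : (0:ℝ) < (2:ℝ) ^ (-(j:ℤ)) := by positivity
    have hs2 := h.two_zpow_le
    have key : ∀ i, validJK (j + 1) i → ∀ s, t₁ ≤ s → s ≤ t₂ →
        slope3 (γ s) ≤ tan (angJK (j + 1) i) - slopeWidth ε (j + 1) i →
        tan (angJK (j + 1) i) ≤ slope3 (γ t₂) →
        ENNReal.ofReal (20 / 3 * (2:ℝ) ^ (-(j:ℤ))) ≤ eVariationOn γ (Icc t₁ t₂) ∨
        ∃ t q, s ≤ t ∧ t ≤ q ∧ q ≤ t₂ ∧ slope3 (γ q) = tan (angJK (j + 1) i) ∧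
          γ t 0 < cJK (j + 1) i ∧ slope3 (γ t) ≤ tan (angJK (j + 1) i) ∧
          tan (angJK (j + 1) i) - slopeWidth ε (j + 1) i ≤ slope3 (γ t) := by
      intro i hi s hs hst hsl hsl'
      obtain ⟨q, hsq, hq, hfq, ⟨t, hst, htq, hX, hf⟩ | ⟨t, hst, htq, hX⟩ | hV⟩ :=
        hS.crossing hA hi (ht₁.trans hs) hst ht₂ hsl hsl'
      · exact Or.inr ⟨t, q, hst, htq, hq, hfq, hX, hf⟩
      · refine Or.inl ?_
        have hci := hi.cJK_ge
        rw [two_zpow_neg_succ] at hci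
        have hc := h.cJK_le
        have hc' := h'.cJK_le
        have htt : t₁ ≤ t := hs.trans hst
        have htt' : t ≤ t₂ := htq.trans hq
        have h1 := abs_apply_zero_sub_le_dist (γ t₁) (γ t)
        have h2 := abs_apply_zero_sub_le_dist (γ t) (γ t₂)
        refine ofReal_le_eVariationOn_of_subset γ le_rfl le_rfl ?_ (ofReal_add_le_eVariationOn γ
          htt htt' dist_nonneg dist_nonneg (ofReal_le_eVariationOn_of_le_dist γ htt le_rfl)
          (ofReal_le_eVariationOn_of_le_dist γ htt' le_rfl))
        linarith [neg_abs_le (γ t₁ 0 - γ t 0), le_abs_self (γ t 0 - γ t₂ 0)]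
      · exact Or.inl (ofReal_le_eVariationOn_of_subset γ hs hq (by linarith) hV)
    have hπ := pi_gt_d2
    obtain ⟨m, hm⟩ : ∃ m, m = ⌊2 * π * k⌋₊ := ⟨_, rfl⟩
    have hm1 : (m:ℝ) ≤ 2 * π * k := hm ▸ Nat.floor_le (by positivity)
    have hm2 : 2 * π * k < m + 1 := hm ▸ Nat.lt_floor_add_one _
    have hk' : (k:ℝ) + 1 ≤ k' := by exact_mod_cast hkk'
    have hmk' : (m:ℝ) + 4 + 228 / 100 ≤ 2 * π * k' := by nlinarith
    have hv : ∀ i, 1 ≤ i → i ≤ m + 4 → validJK (j + 1) i := fun i hi him => by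
      refine ⟨by omega, hi, Nat.le_floor ?_⟩
      have h1 : (k' : ℝ) ≤ (2 * π) ^ j :=
        (Nat.cast_le.2 h'.2.2).trans (Nat.floor_le (by positivity))
      have h2 : (i:ℝ) ≤ m + 4 := by exact_mod_cast him
      rw [pow_succ]
      nlinarith
    have hv1 := hv (m + 2) (by omega) (by omega)
    have hv2 := hv (m + 3) (by omega) (by omega)
    have hv3 := hv (m + 4) (by omega) (by omega)
    have hU := angStep_pos (j + 1)
    have hU' := four_thirds_angStep_succ_le (j + 1)
    have hang (k : ℕ) : angJK j k = 2 * π * k * angStep (j + 1) := by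
      rw [angJK_eq, angStep_eq]; ring
    have o1 : tan (angJK j k) ≤
        tan (angJK (j + 1) (m + 2)) - slopeWidth ε (j + 1) (m + 2) :=
      hS.tan_le_tan_sub_slopeWidth hv1 h.angJK_pos.le (by
        rw [hang, angJK_eq]; push_cast; nlinarith)
    have o2 : tan (angJK (j + 1) (m + 2)) ≤
        tan (angJK (j + 1) (m + 3)) - slopeWidth ε (j + 1) (m + 3) :=
      hS.tan_le_tan_sub_slopeWidth hv2 hv1.angJK_pos.le (by
        rw [angJK_eq, angJK_eq]; push_cast; nlinarith)
    have o3 : tan (angJK (j + 1) (m + 3)) ≤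
        tan (angJK (j + 1) (m + 4)) - slopeWidth ε (j + 1) (m + 4) :=
      hS.tan_le_tan_sub_slopeWidth hv3 hv2.angJK_pos.le (by
        rw [angJK_eq, angJK_eq]; push_cast; nlinarith)
    have o4 : tan (angJK (j + 1) (m + 4)) ≤ tan (angJK j k') - slopeWidth ε j k' :=
      hS.tan_le_tan_sub_slopeWidth h' hv3.angJK_pos.le (by
        rw [hang, angJK_eq]; push_cast; nlinarith)
    have w2 := hS.slopeWidth_nonneg hv2
    have w3 := hS.slopeWidth_nonneg hv3
    obtain hV | ⟨p₁, q₁, hp₁, hpq₁, hq₁, hf₁, hX₁, hu₁, -⟩ :=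
      key _ hv1 t₁ le_rfl ht (hs₁.trans o1) (by linarith)
    · exact hV
    obtain hV | ⟨p₂, q₂, hp₂, hpq₂, hq₂, hf₂, hX₂, hu₂, hl₂⟩ :=
      key _ hv2 q₁ (by linarith) hq₁ (by linarith) (by linarith)
    · exact hV
    obtain hV | ⟨p₃, q₃, hp₃, hpq₃, hq₃, hf₃, hX₃, -, hl₃⟩ :=
      key _ hv3 q₂ (by linarith) hq₂ (by linarith) (by linarith)
    · exact hV
    have g1 := ih (by omega) hv1 hv2 (by omega) (by linarith) (by linarith) (by linarith) hu₁ hX₁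
      hl₂ hX₂
    have g2 := ih (by omega) hv2 hv3 (by omega) (by linarith) (by linarith) (by linarith) hu₂ hX₂
      hl₃ hX₃
    refine ofReal_le_eVariationOn_of_subset γ hp₁ (hpq₃.trans hq₃) ?_
      (ofReal_add_le_eVariationOn γ (by linarith) (by linarith) (by positivity) (by positivity)
        g1 g2)
    rw [two_zpow_neg_succ]
    linarith

lemma validJK_one (hk : 1 ≤ k) (hk' : k ≤ 6) : validJK 1 k := by
  refine ⟨le_rfl, hk, Nat.le_floor ?_⟩
  have : (k:ℝ) ≤ 6 := by exact_mod_cast hk'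
  linarith [pi_gt_three]

/-- Counting the strips of the first level passed by a curve inside the truncated cone. -/
lemma exists_count (hS : StripSystem ε M) (hA : AvoidingCurve ε M γ)
    (hX : ∀ t ∈ Icc (0:ℝ) 1, γ t 0 ≤ 4) (hs₀ : slope3 (γ 0) ≤ 0)
    (hs₁ : tan (π / 6) ≤ slope3 (γ 1)) {J : ℕ}
    (hJ : ∀ t ∈ Icc (0:ℝ) 1, (2:ℝ) ^ (-(J:ℤ)) ≤ γ t 0) {n : ℕ} (hn : n ≤ 6) :
    ∃ (m l : ℕ) (T : ℝ), m + l = n ∧ T ∈ Icc (0:ℝ) 1 ∧ slope3 (γ T) ≤ tan (angJK 1 n) ∧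
      ENNReal.ofReal (m * (10 / 3)) ≤ eVariationOn γ (Icc 0 T) ∧
      (l = 0 ∨ ∃ (l' k : ℕ) (τ : ℝ), l = l' + 1 ∧ 1 ≤ k ∧ k ≤ n ∧ τ ∈ Icc 0 T ∧
        γ τ 0 < cJK 1 k ∧ slope3 (γ τ) ≤ tan (angJK 1 k) ∧
        ENNReal.ofReal (l' * (10 / 3)) ≤ eVariationOn γ (Icc 0 τ)) := by
  induction n with
  | zero => exact ⟨0, 0, 0, rfl, by simp, by simpa [angJK_eq] using hs₀, by simp, Or.inl rfl⟩
  | succ n ih =>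
    obtain ⟨m, l, T, hml, hT, hsT, hV, hl⟩ := ih (by omega)
    have hv : validJK 1 (n + 1) := validJK_one (by omega) hn
    have hU := angStep_pos 1
    have hU' := four_thirds_angStep_succ_le 1
    have ho := hS.tan_le_tan_sub_slopeWidth hv (x := angJK 1 n)
      (by rw [angJK_eq]; positivity)
      (by rw [angJK_eq, angJK_eq]; push_cast; linarith)
    have h1 := sub_le_tan_sub_tan hv.angJK_pos.le hv.angJK_le le_rfl
    obtain ⟨q, hTq, hq, hfq, ⟨t, hTt, htq, hXt, hu, hl'⟩ | ⟨t, hTt, htq, hXt⟩ | hV'⟩ :=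
      hS.crossing hA hv hT.1 hT.2 le_rfl (hsT.trans ho) (by linarith [hv.angJK_le])
    · refine ⟨m, l + 1, q, by omega, ⟨hT.1.trans hTq, hq⟩, hfq.le,
        ofReal_le_eVariationOn_of_subset γ le_rfl hTq le_rfl hV, Or.inr ?_⟩
      refine ⟨l, n + 1, t, rfl, by omega, le_rfl, ⟨hT.1.trans hTt, htq⟩, hXt, hu, ?_⟩
      obtain rfl | ⟨l', k, τ, rfl, hk1, hk, hτ, hXτ, hsτ, hVτ⟩ := hl
      · simp
      have hg := hS.gap hA hJ J (by omega) (validJK_one hk1 (by omega)) hv (by omega) hτ.1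
        (hτ.2.trans hTt) (htq.trans hq) hsτ hXτ hl' hXt
      refine ofReal_le_eVariationOn_of_subset γ le_rfl le_rfl ?_ (ofReal_add_le_eVariationOn γ
        hτ.1 (hτ.2.trans hTt) (by positivity) (by positivity) hVτ hg)
      push_cast
      norm_num
      linarith
    · have h2 := hX t ⟨hT.1.trans hTt, htq.trans hq⟩
      have h3 := hv.cJK_ge
      norm_num at h3
      linarith
    · refine ⟨m + 1, l, q, by omega, ⟨hT.1.trans hTq, hq⟩, hfq.le, ?_, ?_⟩
      · refine ofReal_le_eVariationOn_of_subset γ le_rfl le_rfl ?_ (ofReal_add_le_eVariationOn γ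
          hT.1 hTq (by positivity) (by positivity) hV hV')
        push_cast
        linarith
      · obtain rfl | ⟨l', k, τ, hl', hk1, hk, hτ, hrest⟩ := hl
        · exact Or.inl rfl
        · exact Or.inr ⟨l', k, τ, hl', hk1, by omega, ⟨hτ.1, hτ.2.trans hTq⟩, hrest⟩

/-- A curve inside the truncated cone which avoids the spiral strips and crosses all their slopes
has length at least `10`. -/
theorem ten_le_eVariationOn (hS : StripSystem ε M) (hA : AvoidingCurve ε M γ)
    (hX : ∀ t ∈ Icc (0:ℝ) 1, γ t 0 ≤ 4) (hs₀ : slope3 (γ 0) ≤ 0)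
    (hs₁ : tan (π / 6) ≤ slope3 (γ 1)) :
    ENNReal.ofReal 10 ≤ eVariationOn γ (Icc (0:ℝ) 1) := by
  obtain ⟨J, hJ⟩ : ∃ J : ℕ, ∀ t ∈ Icc (0:ℝ) 1, (2:ℝ) ^ (-(J:ℤ)) ≤ γ t 0 := by
    obtain ⟨t₀, ht₀, hmin⟩ := isCompact_Icc.exists_isMinOn ⟨0, by simp⟩
      ((EuclideanSpace.proj (𝕜 := ℝ) (0 : Fin 3)).continuous.comp_continuousOn hA.continuousOn)
    obtain ⟨J, hJ⟩ := exists_pow_lt_of_lt_one (hA.pos t₀ ht₀) (show (1 / 2 : ℝ) < 1 by norm_num)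
    refine ⟨J, fun t ht => le_trans ?_ (hmin ht)⟩
    rw [zpow_neg, zpow_natCast, ← inv_pow, ← one_div]
    exact hJ.le
  obtain ⟨m, l, T, hml, hT, -, hV, hl⟩ := hS.exists_count hA hX hs₀ hs₁ hJ le_rfl
  rcases le_or_gt 3 m with hm | hm
  · have : (3:ℝ) ≤ m := by exact_mod_cast hm
    exact ofReal_le_eVariationOn_of_subset γ le_rfl hT.2 (by linarith) hV
  · obtain rfl | ⟨l', k, τ, rfl, -, -, hτ, -, -, hVτ⟩ := hl
    · omega
    have : (3:ℝ) ≤ l' := by exact_mod_cast (show 3 ≤ l' by omega)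
    exact ofReal_le_eVariationOn_of_subset γ le_rfl (hτ.2.trans hT.2) (by linarith) hVτ

end StripSystem

lemma bounds_of_mem_convexHull {y : EuclideanSpace ℝ (Fin 3)}
    (hy : y ∈ convexHull ℝ {0, (4:ℝ) • dirPt 0, (4:ℝ) • dirPt (π / 6)}) :
    y 1 ≤ y 0 ∧ y 0 ≤ 4 := by
  have h : convexHull ℝ {0, (4:ℝ) • dirPt 0, (4:ℝ) • dirPt (π / 6)} ⊆
      {y : EuclideanSpace ℝ (Fin 3) | y 1 ≤ y 0 ∧ y 0 ≤ 4} := by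
    refine convexHull_min ?_ ?_
    · rintro y (rfl | rfl | rfl)
      · simp
      · simp
      · have h1 := cos_sq_ge_of_le (show 0 ≤ π / 6 by positivity) le_rfl
        have h2 : 0 ≤ cos (π / 6) := by rw [cos_pi_div_six]; positivity
        simp only [mem_ofPred_eq, PiLp.smul_apply, dirPt_apply_zero, dirPt_apply_one, smul_eq_mul,
          sin_pi_div_six]
        constructor <;> nlinarith [cos_le_one (π / 6)]
    · intro x hx y hy a b ha hb hab
      obtain ⟨hx1, hx2⟩ := hx
      obtain ⟨hy1, hy2⟩ := hy
      simp only [mem_ofPred_eq, PiLp.add_apply, PiLp.smul_apply, smul_eq_mul]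
      constructor <;> nlinarith
  exact h hy

lemma pos_of_Proj3_mem {x : EuclideanSpace ℝ (Fin 3)} (hx : x ≠ 0) (h : Proj3 x 1 ≤ Proj3 x 0) :
    0 < x 0 := by
  rw [Proj3_apply_one, Proj3_apply_zero] at h
  by_contra! hneg
  have h1 : √(x 1 ^ 2 + x 2 ^ 2) = 0 := le_antisymm (h.trans hneg) (sqrt_nonneg _)
  have h0 : x 0 = 0 := le_antisymm hneg (by linarith)
  rw [sqrt_eq_zero (by positivity)] at h1
  have hy : x 1 = 0 :=
    pow_eq_zero_iff two_ne_zero |>.1 (by linarith [sq_nonneg (x 1), sq_nonneg (x 2)])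
  have hz : x 2 = 0 :=
    pow_eq_zero_iff two_ne_zero |>.1 (by linarith [sq_nonneg (x 1), sq_nonneg (x 2)])
  refine hx ?_
  ext i
  fin_cases i
  exacts [h0, hy, hz]

/-- assertion (∗₃) of Theorem 2: with `A` at angle `0` and `D` at angle
`π/6` (unit vectors), for every space curve `γ` of length `< 10` joining `A` and `D`,
contained in the truncated cone `K_{4ΔAOD} ∖ {O}`, and disjoint from all spiral strips
`S_j^k`, there is a plane curve `γ̃` in `4·Δ(AOD) ∖ {O}` joining `A` and `D`, disjoint
from all segments `I_j^k`, with `l(γ̃) ≤ (5/2)·l(Proj γ)`. -/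
theorem stmt14 (ε : ℕ → ℕ → ℝ) (M : ℕ → ℕ → ℕ)
    (hε : ∀ j k, validJK j k → 0 < ε j k)
    (hsmall : ∀ j k, validJK j k → ε j k * (2 * π * M j k) < rJK j k)
    (hLab : ∀ j k, validJK j k → LabyrinthProp (cJK j k) (rJK j k) (ε j k) (M j k))
    (hdisj : ∀ j k j' k', validJK j k → validJK j' k' → (j, k) ≠ (j', k') →
      Disjoint (spiralStrip (cJK j k) (rJK j k) (ε j k) (M j k))
        (spiralStrip (cJK j' k') (rJK j' k') (ε j' k') (M j' k')))
    (γ : ℝ → EuclideanSpace ℝ (Fin 3)) (hγ : ContinuousOn γ (Icc 0 1))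
    (h0 : γ 0 = dirPt 0) (h1 : γ 1 = dirPt (π / 6))
    (hcone : ∀ t ∈ Icc (0:ℝ) 1, γ t ≠ 0 ∧
      Proj3 (γ t) ∈ convexHull ℝ {0, (4:ℝ) • dirPt 0, (4:ℝ) • dirPt (π / 6)})
    (hlen : eVariationOn γ (Icc (0:ℝ) 1) < ENNReal.ofReal 10)
    (havoid : ∀ t ∈ Icc (0:ℝ) 1, ∀ j k, validJK j k →
      γ t ∉ spiralStrip (cJK j k) (rJK j k) (ε j k) (M j k)) :
    ∃ γ' : ℝ → EuclideanSpace ℝ (Fin 3), ContinuousOn γ' (Icc 0 1) ∧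
      γ' 0 = dirPt 0 ∧ γ' 1 = dirPt (π / 6) ∧
      (∀ t ∈ Icc (0:ℝ) 1, γ' t ≠ 0 ∧
        γ' t ∈ convexHull ℝ {0, (4:ℝ) • dirPt 0, (4:ℝ) • dirPt (π / 6)} ∧
        ∀ j k, validJK j k → γ' t ∉ segJK j k) ∧
      eVariationOn γ' (Icc (0:ℝ) 1) ≤
        ENNReal.ofReal (5 / 2) * eVariationOn (fun t => Proj3 (γ t)) (Icc (0:ℝ) 1) := by
  have hS : StripSystem ε M := ⟨hε, hsmall, hLab, hdisj⟩
  have hA : AvoidingCurve ε M γ :=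
    ⟨hγ, fun t ht => pos_of_Proj3_mem (hcone t ht).1 (bounds_of_mem_convexHull (hcone t ht).2).1,
      havoid⟩
  refine absurd hlen (not_lt.2 (hS.ten_le_eVariationOn hA
    (fun t ht => (bounds_of_mem_convexHull (hcone t ht).2).2) ?_ ?_))
  · simp [h0, slope3]
  · simp [h1, slope3, tan_eq_sin_div_cos]
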